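/- arXiv:math/0203177 — 2 statements merged into one kernel-verified Lean document; each statement's English description precedes it below -/
import Mathlib

section
/- For every k≥2, every x∈Λ_k and every n∈ℕ, the sum of the coordinates is preserved by the transformation G^{(k)}: ∑_{i=1}^k (G^{(k)}(x))_i(n) = ∑_{i=1}^k x_i(n). -/
noncomputable def minOp (x y : ℕ → ℤ) : ℕ → ℤ := fun n =>
  Finset.inf' (Finset.range (n+1)) (by simp) (fun m => x m + y n - y m)

noncomputable def maxOp (x y : ℕ → ℤ) : ℕ → ℤ := fun n =>
  Finset.sup' (Finset.range (n+1)) (by simp) (fun m => x m + y n - y m)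

/-- `Dseq x i = x 0 ⊓ x 1 ⊓ ⋯ ⊓ x i` (left to right). -/
noncomputable def Dseq (x : ℕ → ℕ → ℤ) : ℕ → (ℕ → ℤ)
  | 0 => x 0
  | i+1 => minOp (Dseq x i) (x (i+1))

/-- `Tseq x i = x (i+1) ⊔ (x 0 ⊓ ⋯ ⊓ x i)`. -/
noncomputable def Tseq (x : ℕ → ℕ → ℤ) : ℕ → (ℕ → ℤ) :=
  fun i => maxOp (x (i+1)) (Dseq x i)

/-- The path transformation `G^{(k)}` (coordinates `0,…,k-1`). -/
noncomputable def G : ℕ → (ℕ → ℕ → ℤ) → (ℕ → ℕ → ℤ)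
  | 0, x => x
  | 1, x => x
  | (k+2), x => fun i => match i with
      | 0 => Dseq x (k+1)
      | (j+1) => G (k+1) (Tseq x) j

/-- Membership in `Λ_k`: starts at the origin and at each step either stays put
or increases exactly one of the first `k` coordinates by `1`. -/
def IsLambdaPath (k : ℕ) (x : ℕ → ℕ → ℤ) : Prop :=
  (∀ i, i < k → x i 0 = 0) ∧
  ∀ n, (∀ i, i < k → x i (n+1) = x i n) ∨
    ∃ j, j < k ∧ x j (n+1) = x j n + 1 ∧ ∀ i, i < k → i ≠ j → x i (n+1) = x i n

theorem minOp_add_maxOp (x y : ℕ → ℤ) (n : ℕ) : minOp x y n + maxOp y x n = x n + y n := by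
  apply le_antisymm
  · obtain ⟨m, hm, h⟩ := Finset.exists_mem_eq_sup' (s := Finset.range (n+1)) (by simp)
      (fun m => y m + x n - x m)
    have h2 : minOp x y n ≤ x m + y n - y m :=
      Finset.inf'_le (fun m => x m + y n - y m) hm
    have h3 : maxOp y x n = y m + x n - x m := h
    linarith
  · obtain ⟨m, hm, h⟩ := Finset.exists_mem_eq_inf' (s := Finset.range (n+1)) (by simp)
      (fun m => x m + y n - y m)
    have h2 : y m + x n - x m ≤ maxOp y x n :=
      Finset.le_sup' (fun m => y m + x n - x m) hm
    have h3 : minOp x y n = x m + y n - y m := h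
    linarith

theorem D_add_T (x : ℕ → ℕ → ℤ) (n j : ℕ) :
    Dseq x j n + ∑ i ∈ Finset.range j, Tseq x i n = ∑ i ∈ Finset.range (j+1), x i n := by
  induction j with
  | zero => simp [Dseq]
  | succ j ih =>
    rw [Finset.sum_range_succ, Finset.sum_range_succ _ (j+1), ← ih]
    have h := minOp_add_maxOp (Dseq x j) (x (j+1)) n
    simp only [Dseq, Tseq] at *
    linarith

theorem G_sum (n k : ℕ) : ∀ x : ℕ → ℕ → ℤ,
    ∑ i ∈ Finset.range (k+1), G (k+1) x i n = ∑ i ∈ Finset.range (k+1), x i n := by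
  induction k with
  | zero => intro x; simp [G]
  | succ k ih =>
    intro x
    rw [Finset.sum_range_succ', ← D_add_T x n (k+1)]
    simp only [G]
    rw [ih (Tseq x), add_comm]

/-- `G^{(k)}` preserves the sum of the coordinates. -/
theorem stmt2 (k : ℕ) (hk : 2 ≤ k) (x : ℕ → ℕ → ℤ) (hx : IsLambdaPath k x) (n : ℕ) :
    ∑ i ∈ Finset.range k, G k x i n = ∑ i ∈ Finset.range k, x i n := by
  obtain ⟨k, rfl⟩ : ∃ j, k = j + 1 := ⟨k - 1, by omega⟩
  exact G_sum n k x
end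

section
/- Kostka branching identity: let k≥1, let x=(x_1≥⋯≥x_k≥0) be a partition with at most k parts and let z∈ℤ_+^k. Then ∑_{i=1}^k κ_{x+e_i, z} = ∑_{i=1}^k κ_{x, z−e_i}, where on the left the summand is taken to be 0 whenever x+e_i is not a partition (i.e. when i>1 and x_i=x_{i−1}), and on the right the summand is taken to be 0 whenever z_i=0. -/
/-- The cells of the Young diagram of shape `lam` (row lengths), within the
first `k` rows. -/
def cells (k : ℕ) (lam : ℕ → ℕ) : Finset (ℕ × ℕ) :=
  (Finset.range k ×ˢ Finset.range ((Finset.range k).sup lam)).filter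
    (fun rc => rc.2 < lam rc.1)

/-- `T` is a semistandard Young tableau of shape `lam` with entries in
`{0,…,k-1}` (0-based version of entries `{1,…,k}`): rows weakly increase,
columns strictly increase, and `T` vanishes outside the diagram. -/
def IsSSYT (k : ℕ) (lam : ℕ → ℕ) (T : ℕ → ℕ → ℕ) : Prop :=
  (∀ r c, c < lam r → T r c < k) ∧
  (∀ r c, ¬ c < lam r → T r c = 0) ∧
  (∀ r c c', c ≤ c' → c' < lam r → T r c ≤ T r c') ∧
  (∀ r r' c, r < r' → c < lam r' → T r c < T r' c)

/-- Number of entries of `T` (of shape `lam`, within `k` rows) equal to `i`. -/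
def entryCount (k : ℕ) (lam : ℕ → ℕ) (T : ℕ → ℕ → ℕ) (i : ℕ) : ℕ :=
  ((cells k lam).filter (fun rc => T rc.1 rc.2 = i)).card

/-- The Schur polynomial `s_lam(p) = ∑_T p^{weight(T)}`, summing over all
semistandard tableaux of shape `lam` with entries in `{0,…,k-1}`. -/
noncomputable def schur (k : ℕ) (lam : ℕ → ℕ) (p : ℕ → ℝ) : ℝ :=
  ∑' T : {T : ℕ → ℕ → ℕ // IsSSYT k lam T},
    ∏ i ∈ Finset.range k, p i ^ entryCount k lam T.1 i

/-- The Kostka number `κ_{lam,w}`: the number of semistandard tableaux of shape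
`lam` with entries in `{0,…,k-1}` and weight `w`. -/
noncomputable def kostka (k : ℕ) (lam : ℕ → ℕ) (w : ℕ → ℕ) : ℕ :=
  Set.ncard {T : ℕ → ℕ → ℕ | IsSSYT k lam T ∧ ∀ i, i < k → entryCount k lam T i = w i}

/-- The reversed vector `x^*` of a nonnegative integer vector, as a shape. -/
def revPartZ (k : ℕ) (x : ℕ → ℤ) : ℕ → ℕ :=
  fun j => if j < k then (x (k-1-j)).toNat else 0

open Finset in
theorem aux_entryCount (k : ℕ) (l : ℕ → ℕ) (T : ℕ → ℕ → ℕ) (i : ℕ) :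
    entryCount k l T i = ∑ r ∈ range k, ((range (l r)).filter (fun c => T r c = i)).card := by
  unfold entryCount
  rw [← Finset.card_sigma]
  refine Finset.card_bij' (fun p _ => ⟨p.1, p.2⟩) (fun p _ => (p.1, p.2)) ?_ ?_ ?_ ?_
  · rintro ⟨r, c⟩ h
    simp only [cells, mem_filter, mem_product, mem_range, mem_sigma] at h ⊢
    tauto
  · rintro ⟨r, c⟩ h
    simp only [cells, mem_filter, mem_product, mem_range, mem_sigma] at h ⊢
    refine ⟨⟨⟨h.1, lt_of_lt_of_le h.2.1 ?_⟩, h.2.1⟩, h.2.2⟩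
    exact Finset.le_sup (f := l) (mem_range.2 h.1)
  · rintro ⟨r, c⟩ h; rfl
  · rintro ⟨r, c⟩ h; rfl

def Intl (k : ℕ) (l n : ℕ → ℕ) : Prop :=
  (∀ j, j < k → l (j+1) ≤ n j ∧ n j ≤ l j) ∧ ∀ j, k ≤ j → n j = 0

def shp (k : ℕ) (l : ℕ → ℕ) (T : ℕ → ℕ → ℕ) : ℕ → ℕ :=
  fun r => ((Finset.range (l r)).filter (fun c => T r c < k)).card

theorem aux_down (n : ℕ) (p : ℕ → Prop) [DecidablePred p]
    (h : ∀ c c', c ≤ c' → c' < n → p c' → p c) :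
    ∀ c, c < n → (p c ↔ c < ((Finset.range n).filter p).card) := by
  have : ∃ m, (Finset.range n).filter p = Finset.range m := by
    induction n with
    | zero => exact ⟨0, by simp⟩
    | succ n ih =>
      obtain ⟨m, hm⟩ := ih (fun c c' h1 h2 => h c c' h1 (by omega))
      by_cases hp : p n
      · refine ⟨n+1, ?_⟩
        ext c
        simp only [Finset.mem_filter, Finset.mem_range]
        exact ⟨fun h => h.1, fun hc => ⟨hc, h c n (by omega) (by omega) hp⟩⟩
      · refine ⟨m, ?_⟩
        rw [← hm, Finset.range_add_one, Finset.filter_insert, if_neg hp]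
  obtain ⟨m, hm⟩ := this
  intro c hc
  rw [hm, Finset.card_range, ← Finset.mem_range (m := c), ← hm]
  simp [hc]

theorem aux_shp {k : ℕ} {l : ℕ → ℕ} {T : ℕ → ℕ → ℕ} (hT : IsSSYT (k+1) l T) (r c : ℕ)
    (hc : c < l r) : T r c < k ↔ c < shp k l T r :=
  aux_down (l r) (fun c => T r c < k)
    (fun a b hab hb h => lt_of_le_of_lt (hT.2.2.1 r a b hab hb) h) c hc

theorem aux_shp_le (k : ℕ) (l : ℕ → ℕ) (T : ℕ → ℕ → ℕ) (r : ℕ) : shp k l T r ≤ l r := by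
  unfold shp
  exact (Finset.card_filter_le _ _).trans (by simp)

theorem aux_row_le {k : ℕ} {l : ℕ → ℕ} (hl : Antitone l) {T : ℕ → ℕ → ℕ} (hT : IsSSYT k l T) :
    ∀ r c, c < l r → r ≤ T r c := by
  intro r
  induction r with
  | zero => intros; omega
  | succ r ih =>
    intro c hc
    have h1 := ih c (lt_of_lt_of_le hc (hl (Nat.le_succ r)))
    have h2 := hT.2.2.2 r (r+1) c (by omega) hc
    omega

theorem aux_intl_shp {k : ℕ} {l : ℕ → ℕ} (hl : Antitone l) (h0 : ∀ j, k + 1 ≤ j → l j = 0)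
    {T : ℕ → ℕ → ℕ} (hT : IsSSYT (k+1) l T) : Intl k l (shp k l T) := by
  refine ⟨fun j hj => ⟨?_, aux_shp_le k l T j⟩, fun j hj => ?_⟩
  · by_contra hlt
    push Not at hlt
    have hle := hl (Nat.le_succ j)
    have h1 := hT.2.2.2 j (j+1) _ (by omega) hlt
    have h2 := hT.1 (j+1) _ hlt
    have h3 := (aux_shp hT j (shp k l T j) (lt_of_lt_of_le hlt hle)).1 (by omega)
    omega
  · by_contra hne
    have hle := aux_shp_le k l T j
    have h3 := (aux_shp hT j 0 (by omega)).2 (by omega)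
    have := aux_row_le hl hT j 0 (by omega)
    omega

theorem Intl.anti {k : ℕ} {l n : ℕ → ℕ} (h : Intl k l n) : Antitone n := by
  apply antitone_nat_of_succ_le
  intro j
  by_cases hj : j + 1 < k
  · exact (h.1 (j+1) hj).2.trans (h.1 j (by omega)).1
  · rw [h.2 (j+1) (by omega)]; omega

theorem aux_finite {k : ℕ} {l : ℕ → ℕ} (hl : Antitone l) (h0 : ∀ j, k ≤ j → l j = 0) :
    {T | IsSSYT k l T}.Finite := by
  refine Set.Finite.of_finite_image
    (f := fun (T : ℕ → ℕ → ℕ) (p : Fin k × Fin (l 0)) => T p.1 p.2) ?_ ?_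
  · refine (Set.Finite.pi' (t := fun _ => Set.Iic k) (fun _ => Set.finite_Iic k)).subset ?_
    rintro _ ⟨T, hT, rfl⟩ p
    by_cases hp : (p.2 : ℕ) < l p.1
    · exact (hT.1 _ _ hp).le
    · simp [hT.2.1 _ _ hp]
  · intro T hT T' hT' h
    funext r c
    by_cases hc : c < l r
    · have hr : r < k := by
        by_contra hr
        rw [h0 r (by omega)] at hc; omega
      exact congrFun h (⟨r, hr⟩, ⟨c, lt_of_lt_of_le hc (hl (Nat.zero_le r))⟩)
    · rw [hT.2.1 _ _ hc, hT'.2.1 _ _ hc]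

theorem aux_finite' (k M : ℕ) :
    {n : ℕ → ℕ | Antitone n ∧ (∀ j, k ≤ j → n j = 0) ∧ ∀ j, n j ≤ M}.Finite := by
  refine Set.Finite.of_finite_image (f := fun (n : ℕ → ℕ) (p : Fin k) => n p) ?_ ?_
  · refine (Set.Finite.pi' (t := fun _ => Set.Iic M) (fun _ => Set.finite_Iic M)).subset ?_
    rintro _ ⟨T, hT, rfl⟩ p
    exact hT.2.2 _
  · intro T hT T' hT' h
    funext r
    by_cases hr : r < k
    · exact congrFun h ⟨r, hr⟩
    · rw [hT.2.1 _ (by omega), hT'.2.1 _ (by omega)]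

noncomputable def shapes (k M : ℕ) : Finset (ℕ → ℕ) := (aux_finite' k M).toFinset

theorem mem_shapes {k M : ℕ} {n : ℕ → ℕ} :
    n ∈ shapes k M ↔ Antitone n ∧ (∀ j, k ≤ j → n j = 0) ∧ ∀ j, n j ≤ M := by
  simp [shapes]

theorem Intl.mem {k M : ℕ} {l n : ℕ → ℕ} (h : Intl k l n) (hM : l 0 ≤ M) : n ∈ shapes k M := by
  refine mem_shapes.2 ⟨h.anti, h.2, fun j => (h.anti (Nat.zero_le j)).trans ?_⟩
  by_cases hk : 0 < k
  · exact (h.1 0 hk).2.trans hM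
  · rw [h.2 0 (by omega)]; omega

theorem aux_count_top {k : ℕ} {l : ℕ → ℕ} (hl : Antitone l) (h0 : ∀ j, k + 1 ≤ j → l j = 0)
    {T : ℕ → ℕ → ℕ} (hT : IsSSYT (k+1) l T) :
    ∑ r ∈ Finset.range k, shp k l T r + entryCount (k+1) l T k
      = ∑ r ∈ Finset.range (k+1), l r := by
  have h1 : ∑ r ∈ Finset.range k, shp k l T r = ∑ r ∈ Finset.range (k+1), shp k l T r := by
    rw [Finset.sum_range_succ, (aux_intl_shp hl h0 hT).2 k le_rfl, add_zero]
  rw [h1, aux_entryCount, ← Finset.sum_add_distrib]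
  refine Finset.sum_congr rfl fun r _ => ?_
  have : (Finset.range (l r)).filter (fun c => T r c = k)
      = (Finset.range (l r)).filter (fun c => ¬ T r c < k) := by
    refine Finset.filter_congr fun c hc => ?_
    have := hT.1 r c (Finset.mem_range.1 hc)
    omega
  rw [this, shp, Finset.card_filter_add_card_filter_not, Finset.card_range]

def restr (n : ℕ → ℕ) (T : ℕ → ℕ → ℕ) : ℕ → ℕ → ℕ :=
  fun r c => if c < n r then T r c else 0

def fillT (k : ℕ) (l n : ℕ → ℕ) (T : ℕ → ℕ → ℕ) : ℕ → ℕ → ℕ :=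
  fun r c => if c < n r then T r c else if c < l r then k else 0

theorem Intl.le {k : ℕ} {l n : ℕ → ℕ} (h : Intl k l n) (j : ℕ) : n j ≤ l j := by
  by_cases hj : j < k
  · exact (h.1 j hj).2
  · rw [h.2 j (by omega)]; omega

theorem aux_count_low {k : ℕ} {l : ℕ → ℕ} (hl : Antitone l) (h0 : ∀ j, k + 1 ≤ j → l j = 0)
    {T : ℕ → ℕ → ℕ} (hT : IsSSYT (k+1) l T) {i : ℕ} (hi : i < k) :
    entryCount k (shp k l T) (restr (shp k l T) T) i = entryCount (k+1) l T i := by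
  have hI := aux_intl_shp hl h0 hT
  have key : ∀ r, ((Finset.range (shp k l T r)).filter
      (fun c => restr (shp k l T) T r c = i)) = (Finset.range (l r)).filter (fun c => T r c = i) := by
    intro r
    ext c
    rw [Finset.mem_filter, Finset.mem_filter, Finset.mem_range, Finset.mem_range]
    unfold restr
    have := hI.le r
    constructor
    · rintro ⟨h1, h2⟩
      rw [if_pos h1] at h2
      exact ⟨by omega, h2⟩
    · rintro ⟨h1, h2⟩
      have := (aux_shp hT r c h1).1 (by omega)
      rw [if_pos this]
      exact ⟨this, h2⟩
  rw [aux_entryCount, aux_entryCount, Finset.sum_range_succ, ← key k, hI.2 k le_rfl]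
  simp [key]

theorem aux_restr {k : ℕ} {l : ℕ → ℕ} (hl : Antitone l) (h0 : ∀ j, k + 1 ≤ j → l j = 0)
    {T : ℕ → ℕ → ℕ} (hT : IsSSYT (k+1) l T) : IsSSYT k (shp k l T) (restr (shp k l T) T) := by
  have hI := aux_intl_shp hl h0 hT
  refine ⟨fun r c hc => ?_, fun r c hc => if_neg hc, fun r c c' h hc => ?_, fun r r' c h hc => ?_⟩
  · simp only [restr, if_pos hc]
    exact (aux_shp hT r c (lt_of_lt_of_le hc (hI.le r))).2 hc
  · simp only [restr, if_pos hc, if_pos (lt_of_le_of_lt h hc)]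
    exact hT.2.2.1 r c c' h (lt_of_lt_of_le hc (hI.le r))
  · simp only [restr, if_pos hc, if_pos (lt_of_lt_of_le hc (hI.anti h.le))]
    exact hT.2.2.2 r r' c h (lt_of_lt_of_le hc (hI.le r'))

theorem aux_fill_restr {k : ℕ} {l : ℕ → ℕ}
    {T : ℕ → ℕ → ℕ} (hT : IsSSYT (k+1) l T) :
    fillT k l (shp k l T) (restr (shp k l T) T) = T := by
  funext r c
  unfold fillT restr
  split_ifs with h1 h2
  · rfl
  · have := (not_congr (aux_shp hT r c h2)).2 h1
    have := hT.1 r c h2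
    omega
  · exact (hT.2.1 r c h2).symm

theorem aux_fill {k : ℕ} {l n : ℕ → ℕ} (h0 : ∀ j, k + 1 ≤ j → l j = 0)
    (hl : Antitone l) (hI : Intl k l n) {T : ℕ → ℕ → ℕ} (hT : IsSSYT k n T) :
    IsSSYT (k+1) l (fillT k l n T) := by
  have hle := hI.le
  refine ⟨fun r c hc => ?_, fun r c hc => ?_, fun r c c' h hc => ?_, fun r r' c h hc => ?_⟩
  · unfold fillT
    split_ifs with h1
    · have := hT.1 r c h1; omega
    · omega
  · unfold fillT
    have := hle r
    rw [if_neg (by omega), if_neg hc]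
  · unfold fillT
    by_cases h1 : c' < n r
    · rw [if_pos h1, if_pos (by omega)]
      exact hT.2.2.1 r c c' h h1
    · rw [if_neg h1, if_pos hc]
      split_ifs with h2
      · exact (hT.1 r c h2).le
      · exact le_rfl
      · omega
  · have hr' : r' < k + 1 := by
      by_contra hr
      rw [h0 r' (by omega)] at hc; omega
    have h3 : c < n r :=
      lt_of_lt_of_le (lt_of_lt_of_le hc (hl (Nat.succ_le_of_lt h))) (hI.1 r (by omega)).1
    unfold fillT
    rw [if_pos h3]
    split_ifs with h1
    · exact hT.2.2.2 r r' c h h1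
    · exact hT.1 r c h3

theorem aux_restr_fill {k : ℕ} {l n : ℕ → ℕ} {T : ℕ → ℕ → ℕ} (hT : IsSSYT k n T) :
    restr n (fillT k l n T) = T := by
  funext r c
  unfold fillT restr
  split_ifs with h1
  · exact if_pos h1
  · exact (hT.2.1 r c h1).symm

theorem aux_shp_fill {k : ℕ} {l n : ℕ → ℕ} (hI : Intl k l n)
    {T : ℕ → ℕ → ℕ} (hT : IsSSYT k n T) : shp k l (fillT k l n T) = n := by
  funext r
  unfold shp
  have : (Finset.range (l r)).filter (fun c => fillT k l n T r c < k) = Finset.range (n r) := by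
    ext c
    rw [Finset.mem_filter, Finset.mem_range, Finset.mem_range]
    unfold fillT
    have := hI.le r
    constructor
    · rintro ⟨h1, h2⟩
      by_contra h3
      rw [if_neg h3, if_pos h1] at h2
      omega
    · intro h
      rw [if_pos h]
      exact ⟨by omega, hT.1 r c h⟩
  rw [this, Finset.card_range]

open Classical in
theorem kostka_rec {k M : ℕ} {l : ℕ → ℕ} (hl : Antitone l) (h0 : ∀ j, k + 1 ≤ j → l j = 0)
    (hM : l 0 ≤ M) (z : ℕ → ℕ) :
    kostka (k+1) l z = ∑ n ∈ shapes k M,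
      if Intl k l n ∧ ∑ r ∈ Finset.range k, n r + z k = ∑ r ∈ Finset.range (k+1), l r
      then kostka k n z else 0 := by
  have hfin : {T : ℕ → ℕ → ℕ | IsSSYT (k+1) l T ∧
      ∀ i, i < k+1 → entryCount (k+1) l T i = z i}.Finite :=
    (aux_finite hl h0).subset fun T hT => hT.1
  rw [kostka, Set.ncard_eq_toFinset_card _ hfin,
    Finset.card_eq_sum_card_fiberwise (f := shp k l) (t := shapes k M)]
  · refine Finset.sum_congr rfl fun n _ => ?_
    split_ifs with hn
    · obtain ⟨hI, hs⟩ := hn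
      rw [kostka, ← Set.ncard_coe_finset]
      refine Set.ncard_congr (fun T _ => restr n T) ?_ ?_ ?_
      · intro T hT
        simp only [Finset.coe_filter, Set.Finite.mem_toFinset, Set.mem_ofPred_eq] at hT
        obtain ⟨⟨hT, hw⟩, rfl⟩ := hT
        refine ⟨aux_restr hl h0 hT, fun i hi => ?_⟩
        rw [aux_count_low hl h0 hT hi, hw i (by omega)]
      · intro T T' hT hT' he
        simp only [Finset.coe_filter, Set.Finite.mem_toFinset, Set.mem_ofPred_eq] at hT hT'
        have e1 := aux_fill_restr hT.1.1
        have e2 := aux_fill_restr hT'.1.1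
        rw [hT.2] at e1
        rw [hT'.2] at e2
        rw [← e1, ← e2]
        exact congrArg _ he
      · rintro T ⟨hT, hw⟩
        have hF := aux_fill h0 hl hI hT
        have hS : shp k l (fillT k l n T) = n := aux_shp_fill hI hT
        have hR : restr n (fillT k l n T) = T := aux_restr_fill hT
        refine ⟨fillT k l n T, ?_, hR⟩
        simp only [Finset.coe_filter, Set.Finite.mem_toFinset, Set.mem_ofPred_eq]
        refine ⟨⟨hF, fun i hi => ?_⟩, hS⟩
        by_cases hik : i < k
        · rw [← aux_count_low hl h0 hF hik, hS, hR, hw i hik]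
        · obtain rfl : i = k := by omega
          have := aux_count_top hl h0 hF
          rw [hS] at this
          omega
    · rw [Finset.card_eq_zero, Finset.filter_eq_empty_iff]
      intro T hT he
      simp only [Set.Finite.mem_toFinset, Set.mem_ofPred_eq] at hT
      subst he
      refine hn ⟨aux_intl_shp hl h0 hT.1, ?_⟩
      rw [← hT.2 k (by omega)]
      exact aux_count_top hl h0 hT.1
  · intro T hT
    simp only [Finset.mem_coe, Set.Finite.mem_toFinset, Set.mem_ofPred_eq] at hT
    exact (aux_intl_shp hl h0 hT.1).mem hM

theorem kostka_congr {k : ℕ} {l z z' : ℕ → ℕ} (h : ∀ i, i < k → z i = z' i) :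
    kostka k l z = kostka k l z' := by
  unfold kostka
  congr 1
  ext T
  simp only [Set.mem_ofPred_eq]
  refine and_congr_right fun _ => forall_congr' fun i => forall_congr' fun hi => ?_
  rw [h i hi]

theorem aux_sum_add (m i : ℕ) (hi : i < m) (l : ℕ → ℕ) :
    ∑ r ∈ Finset.range m, (if r = i then l r + 1 else l r) = ∑ r ∈ Finset.range m, l r + 1 := by
  have : ∀ r, (if r = i then l r + 1 else l r) = l r + if r = i then 1 else 0 := by
    intro r; split_ifs <;> rfl
  simp [this, Finset.sum_add_distrib, hi]

open Classical in
/-- the local identity -/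
theorem aux_local {k : ℕ} {l n : ℕ → ℕ} (hl : Antitone l) (hn : Antitone n)
    (h0 : ∀ j, k ≤ j → n j = 0) (K : ℕ) :
    (∑ i ∈ Finset.range (k+1), if Intl k (fun j => if j = i then l j + 1 else l j) n then K else 0)
    = (∑ i ∈ Finset.range k,
        if 0 < n i ∧ Intl k l (fun j => if j = i then n j - 1 else n j) then K else 0)
      + if Intl k l n then K else 0 := by
  by_cases h : Intl k l n
  · rw [Finset.sum_range_succ']
    congr 1
    · refine Finset.sum_congr rfl fun i hi => if_congr ?_ rfl rfl
      rw [Finset.mem_range] at hi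
      constructor
      · intro h'
        have h1 := (h'.1 i hi).1
        simp only [if_true] at h1
        refine ⟨by omega, fun j hj => ?_, fun j hj => ?_⟩
        · have h2 := h.1 j hj
          by_cases hji : j = i
          · subst hji; simp only [if_true]; omega
          · simp only [if_neg hji]; omega
        · have := h.2 j hj
          simp only; split_ifs <;> omega
      · rintro ⟨hp, h'⟩
        have h1 := (h'.1 i hi).1
        simp only [if_true] at h1
        refine ⟨fun j hj => ?_, h.2⟩
        have h2 := h.1 j hj
        by_cases hji : j = i
        · subst hji; simp; omega
        · have : j + 1 ≠ i + 1 := by omega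
          simp only [if_neg this]
          split_ifs <;> omega
    · rw [if_pos h, if_pos]
      refine ⟨fun j hj => ?_, h.2⟩
      have h2 := h.1 j hj
      simp only [if_neg (Nat.succ_ne_zero j)]
      split_ifs <;> omega
  · rw [Finset.sum_range_succ, if_neg h, add_zero, if_neg, add_zero]
    · refine Finset.sum_congr rfl fun i hi => if_congr ?_ rfl rfl
      rw [Finset.mem_range] at hi
      constructor
      · intro h'
        have hlt : l i < n i := by
          by_contra hge
          apply h
          refine ⟨fun j hj => ?_, h'.2⟩
          have h2 := h'.1 j hj
          simp only at h2
          by_cases hji : j = i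
          · subst hji; simp at h2; omega
          · simp only [if_neg hji] at h2
            split_ifs at h2 <;> omega
        refine ⟨by omega, fun j hj => ?_, fun j hj => ?_⟩
        · have h2 := h'.1 j hj
          have h3 := hl (Nat.le_succ j)
          by_cases hji : j = i
          · subst hji; simp at h2 ⊢; simp at h3; omega
          · simp only [if_neg hji] at h2 ⊢
            split_ifs at h2 <;> omega
        · have := h'.2 j hj
          simp only; split_ifs <;> omega
      · rintro ⟨hp, h'⟩
        have hlt : l i < n i := by
          by_contra hge
          apply h
          refine ⟨fun j hj => ?_, h0⟩
          have h2 := h'.1 j hj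
          by_cases hji : j = i
          · subst hji; simp at h2; omega
          · simp only [if_neg hji] at h2
            omega
        have hi2 := h'.1 i hi
        simp only [if_true] at hi2
        refine ⟨fun j hj => ?_, h0⟩
        have h2 := h'.1 j hj
        have h3 := hn (Nat.le_succ j)
        simp only [Nat.succ_eq_add_one] at h3
        by_cases hji : j = i
        · subst hji; simp at h2 ⊢; omega
        · simp only [if_neg hji] at h2 ⊢
          by_cases hj1 : j + 1 = i
          · subst hj1; simp; omega
          · simp only [if_neg hj1]; omega
    · intro h'
      apply h
      refine ⟨fun j hj => ?_, h0⟩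
      have h2 := h'.1 j hj
      simp only [if_neg hj.ne] at h2
      split_ifs at h2 <;> omega

theorem aux_anti {k : ℕ} {l : ℕ → ℕ} (h : ∀ j, j + 1 < k → l (j+1) ≤ l j)
    (h0 : ∀ j, k ≤ j → l j = 0) : Antitone l := by
  apply antitone_nat_of_succ_le
  intro j
  by_cases hj : j + 1 < k
  · exact h j hj
  · rw [h0 (j+1) (by omega)]; omega

theorem aux_anti_add {l : ℕ → ℕ} (hl : Antitone l) (i : ℕ) :
    (i = 0 ∨ l i < l (i-1)) ↔ Antitone (fun j => if j = i then l j + 1 else l j) := by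
  constructor
  · intro h
    apply antitone_nat_of_succ_le
    intro j
    have := hl (Nat.le_succ j)
    simp only [Nat.succ_eq_add_one] at this
    by_cases h1 : j + 1 = i
    · subst h1; simp at h ⊢; omega
    · simp only [if_neg h1]; split_ifs <;> omega
  · intro h
    by_cases hi : i = 0
    · exact Or.inl hi
    · right
      have := h (show i - 1 ≤ i by omega)
      simp only [if_true, if_neg (show i - 1 ≠ i by omega)] at this
      omega

open Classical in
theorem aux_shift {k i : ℕ} (hi : i < k) {l : ℕ → ℕ} (C : ℕ) (z : ℕ → ℕ) :
    (∑ m ∈ shapes k (l 0 + 1), if Intl k l m ∧ ∑ r ∈ Finset.range k, m r + z k = C then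
        (if i = 0 ∨ m i < m (i-1) then kostka k (fun j => if j = i then m j + 1 else m j) z else 0)
        else 0)
    = ∑ n ∈ shapes k (l 0 + 1),
        if 0 < n i ∧ Intl k l (fun j => if j = i then n j - 1 else n j) then
          (if ∑ r ∈ Finset.range k, n r + z k = C + 1 then kostka k n z else 0) else 0 := by
  simp only [← ite_and]
  rw [← Finset.sum_filter, ← Finset.sum_filter]
  have e1 : ∀ m : ℕ → ℕ, (fun j => if j = i then (fun j => if j = i then m j + 1 else m j) j - 1
      else (fun j => if j = i then m j + 1 else m j) j) = m := by
    intro m; funext j; by_cases h : j = i <;> simp [h]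
  have e2 : ∀ n : ℕ → ℕ, 0 < n i → (fun j => if j = i then (fun j => if j = i then n j - 1 else n j) j + 1
      else (fun j => if j = i then n j - 1 else n j) j) = n := by
    intro n hn; funext j; by_cases h : j = i
    · subst h; simp; omega
    · simp [h]
  refine Finset.sum_bij' (fun m _ => fun j => if j = i then m j + 1 else m j)
    (fun n _ => fun j => if j = i then n j - 1 else n j) ?_ ?_ ?_ ?_ ?_
  · intro m hm
    rw [Finset.mem_filter] at hm ⊢
    obtain ⟨hmem, ⟨hI, hs⟩, hp⟩ := hm
    refine ⟨mem_shapes.2 ⟨(aux_anti_add hI.anti i).1 hp, fun j hj => ?_, fun j => ?_⟩, ⟨by simp, ?_⟩, ?_⟩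
    · simp only [if_neg (show j ≠ i by omega)]; exact hI.2 j hj
    · have h1 := hI.le j
      have h2 := ((mem_shapes.1 (hI.mem le_rfl)).2.2 j)
      split_ifs <;> omega
    · rw [e1]; exact hI
    · rw [aux_sum_add k i hi]; omega
  · intro n hn
    rw [Finset.mem_filter] at hn ⊢
    obtain ⟨hmem, ⟨hp, hI⟩, hs⟩ := hn
    refine ⟨hI.mem (by omega), ⟨hI, ?_⟩, ?_⟩
    · have := aux_sum_add k i hi (fun j => if j = i then n j - 1 else n j)
      have e := Finset.sum_congr (rfl : Finset.range k = Finset.range k)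
        (fun r _ => congrFun (e2 n hp) r)
      have e3 : ∑ r ∈ Finset.range k, n r
          = ∑ r ∈ Finset.range k, (fun j => if j = i then n j - 1 else n j) r + 1 :=
        e.symm.trans this
      omega
    · rw [aux_anti_add hI.anti i, e2 n hp]
      exact (mem_shapes.1 hmem).1
  · intro m hm; exact e1 m
  · intro n hn
    rw [Finset.mem_filter] at hn
    exact e2 n hn.2.1.1
  · intro m hm; rfl

open Classical in
theorem main_aux (k : ℕ) : ∀ (x : ℕ → ℕ) (_ : Antitone x)
    (_ : ∀ j, k ≤ j → x j = 0) (z : ℕ → ℕ),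
    (∑ i ∈ Finset.range k,
      if i = 0 ∨ x i < x (i-1) then
        kostka k (fun j => if j = i then x j + 1 else x j) z
      else 0)
    = ∑ i ∈ Finset.range k,
        if z i = 0 then 0
        else kostka k x (fun j => if j = i then z j - 1 else z j) := by
  induction k with
  | zero => intros; simp
  | succ k ih =>
    intro l hl h0 z
    set C := ∑ r ∈ Finset.range (k+1), l r with hC
    have hL : ∀ i ∈ Finset.range (k+1), (if i = 0 ∨ l i < l (i-1) then
        kostka (k+1) (fun j => if j = i then l j + 1 else l j) z else 0)
        = ∑ n ∈ shapes k (l 0 + 1), if Intl k (fun j => if j = i then l j + 1 else l j) n then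
          (if ∑ r ∈ Finset.range k, n r + z k = C + 1 then kostka k n z else 0) else 0 := by
      intro i hi
      rw [Finset.mem_range] at hi
      split_ifs with h
      · rw [kostka_rec (M := l 0 + 1) ((aux_anti_add hl i).1 h)]
        · rw [aux_sum_add (k+1) i hi]
          simp only [ite_and, hC]
        · intro j hj
          rw [if_neg (by omega), h0 j hj]
        · split_ifs <;> omega
      · symm
        refine Finset.sum_eq_zero fun n hn => if_neg fun hI => h ?_
        by_cases hi0 : i = 0
        · exact Or.inl hi0
        · right
          have h1 := hI.1 (i-1) (by omega)
          rw [show i - 1 + 1 = i by omega] at h1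
          simp only [if_true, if_neg (show i - 1 ≠ i by omega)] at h1
          omega
    rw [Finset.sum_congr rfl hL, Finset.sum_comm]
    have hloc : ∀ n ∈ shapes k (l 0 + 1), _ := fun n hn =>
      aux_local (k := k) hl (mem_shapes.1 hn).1 (mem_shapes.1 hn).2.1
        (if ∑ r ∈ Finset.range k, n r + z k = C + 1 then kostka k n z else 0)
    rw [Finset.sum_congr rfl hloc, Finset.sum_add_distrib, Finset.sum_comm,
      Finset.sum_range_succ]
    congr 1
    · rw [← Finset.sum_congr rfl (fun i hi => aux_shift (Finset.mem_range.1 hi) C z),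
        Finset.sum_comm]
      have hR : ∀ i ∈ Finset.range k, (if z i = 0 then 0
          else kostka (k+1) l (fun j => if j = i then z j - 1 else z j))
          = ∑ m ∈ shapes k (l 0 + 1), if Intl k l m ∧ ∑ r ∈ Finset.range k, m r + z k = C then
            (if z i = 0 then 0 else kostka k m (fun j => if j = i then z j - 1 else z j)) else 0 := by
        intro i hi
        rw [Finset.mem_range] at hi
        split_ifs with h
        · simp
        · rw [kostka_rec (M := l 0 + 1) hl h0 (by omega)]
          simp only [if_neg (show k ≠ i by omega), hC]
      rw [Finset.sum_congr rfl hR]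
      refine Eq.trans ?_ Finset.sum_comm
      refine Finset.sum_congr rfl fun m hm => ?_
      by_cases hc : Intl k l m ∧ ∑ r ∈ Finset.range k, m r + z k = C
      · simp only [if_pos hc]
        exact ih m hc.1.anti hc.1.2 z
      · simp only [if_neg hc]
    · split_ifs with hz
      · refine Finset.sum_eq_zero fun n hn => ?_
        split_ifs with hI hs
        · exfalso
          have : ∑ r ∈ Finset.range k, n r ≤ ∑ r ∈ Finset.range k, l r :=
            Finset.sum_le_sum fun r _ => hI.le r
          rw [Finset.sum_range_succ] at hC
          omega
        · rfl
        · rfl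
      · rw [kostka_rec (M := l 0 + 1) hl h0 (by omega)]
        refine Finset.sum_congr rfl fun n hn => ?_
        rw [← ite_and]
        refine if_congr (and_congr_right fun _ => ?_) ?_ rfl
        · simp only [if_true, ← hC]
          omega
        · refine kostka_congr fun i hi => ?_
          rw [if_neg (by omega)]

/-- Kostka branching identity: for a partition `x` with at most
`k` parts and `z ∈ ℤ_+^k`,
`∑_i κ_{x+e_i, z} = ∑_i κ_{x, z−e_i}`, where a summand on the left is `0`
whenever `x+e_i` is not a partition and a summand on the right is `0` whenever
`z_i = 0`. -/
theorem stmt15 (k : ℕ) (hk : 1 ≤ k) (x : ℕ → ℕ)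
    (hxpart : ∀ j, j + 1 < k → x (j+1) ≤ x j)
    (hxzero : ∀ j, k ≤ j → x j = 0)
    (z : ℕ → ℕ) :
    (∑ i ∈ Finset.range k,
      if i = 0 ∨ x i < x (i-1) then
        kostka k (fun j => if j = i then x j + 1 else x j) z
      else 0)
    = ∑ i ∈ Finset.range k,
        if z i = 0 then 0
        else kostka k x (fun j => if j = i then z j - 1 else z j) := by
  exact main_aux k x (aux_anti hxpart hxzero) hxzero z
end
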